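/- For m, η real with η ≠ 0 and 1 − 2|ηm| ≥ 0, define the projector family P̂(ξ) on ℂ² for ξ ∈ ℝ² as the spectral projection of the Hermitian matrix Ĥ(ξ) = ξ₁σ₁ + ξ₂σ₂ + (m − η|ξ|²)σ₃ onto its negative eigenvalue. Then (1/(4π)) ∫_{ℝ²} (m + η|k|²) / (|k|² + (m − η|k|²)²)^{3/2} dk = (1/2)(sgn(m) + sgn(η)), where the left-hand side equals the Chern number Ch[P] = (i/2π) ∫_{ℝ²} tr(P̂ [∂₁P̂, ∂₂P̂]) dξ. -/

import Mathlib

noncomputable section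

open MeasureTheory Real

attribute [local instance] Matrix.normedAddCommGroup Matrix.normedSpace

/-- The three Pauli matrices σ₁, σ₂, σ₃ (indexed by 0, 1, 2). -/
def pauli : Fin 3 → Matrix (Fin 2) (Fin 2) ℂ
  | 0 => !![0, 1; 1, 0]
  | 1 => !![0, -Complex.I; Complex.I, 0]
  | 2 => !![1, 0; 0, -1]

/-- The symbol of the regularized two-dimensional Dirac operator. -/
def diracSymbol (m η : ℝ) (ξ : ℝ × ℝ) : Matrix (Fin 2) (Fin 2) ℂ :=
  ξ.1 • pauli 0 + ξ.2 • pauli 1 + (m - η * (ξ.1 ^ 2 + ξ.2 ^ 2)) • pauli 2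

/-- The positive eigenvalue `√(|ξ|² + (m − η|ξ|²)²)` of the Dirac symbol. -/
def diracEnergy (m η : ℝ) (ξ : ℝ × ℝ) : ℝ :=
  Real.sqrt (ξ.1 ^ 2 + ξ.2 ^ 2 + (m - η * (ξ.1 ^ 2 + ξ.2 ^ 2)) ^ 2)

/-- The spectral projection of the Dirac symbol onto its negative eigenvalue. -/
def diracProj (m η : ℝ) (ξ : ℝ × ℝ) : Matrix (Fin 2) (Fin 2) ℂ :=
  (1 / (2 * diracEnergy m η ξ)) •
    ((diracEnergy m η ξ) • (1 : Matrix (Fin 2) (Fin 2) ℂ) - diracSymbol m η ξ)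

lemma pauli_eq : pauli 0 = !![0, 1; 1, 0] ∧ pauli 1 = !![0, -Complex.I; Complex.I, 0] ∧
    pauli 2 = !![1, 0; 0, -1] := ⟨rfl, rfl, rfl⟩

lemma normSq_pos {m : ℝ} (hm : m ≠ 0) (η : ℝ) {u : ℝ} (hu : 0 ≤ u) :
    0 < u + (m - η * u) ^ 2 := by
  rcases hu.eq_or_lt with rfl | hu
  · simpa using pow_pos (abs_pos.2 hm) 2
  · positivity

lemma rpow_three_halves {q : ℝ} (hq : 0 ≤ q) : q ^ ((3 : ℝ) / 2) = √q ^ 3 := by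
  rw [Real.sqrt_eq_rpow, ← Real.rpow_natCast, ← Real.rpow_mul hq]
  norm_num

lemma diracEnergy_pos {m : ℝ} (hm : m ≠ 0) (η : ℝ) (ξ : ℝ × ℝ) : 0 < diracEnergy m η ξ :=
  Real.sqrt_pos.2 (normSq_pos hm η (by positivity))

lemma diracProj_eq {m : ℝ} (hm : m ≠ 0) (η : ℝ) (ξ : ℝ × ℝ) :
    diracProj m η ξ = (1 / 2 : ℝ) • (1 : Matrix (Fin 2) (Fin 2) ℂ) -
      (1 / (2 * diracEnergy m η ξ)) • diracSymbol m η ξ := by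
  have h := (diracEnergy_pos hm η ξ).ne'
  rw [diracProj, smul_sub, smul_smul]
  congr 2
  field_simp

lemma hasFDerivAt_diracSymbol (m η : ℝ) (ξ : ℝ × ℝ) :
    ∃ L : ℝ × ℝ →L[ℝ] Matrix (Fin 2) (Fin 2) ℂ, HasFDerivAt (diracSymbol m η) L ξ ∧
      L (1, 0) = pauli 0 - (2 * η * ξ.1) • pauli 2 ∧
      L (0, 1) = pauli 1 - (2 * η * ξ.2) • pauli 2 := by
  have h1 : HasFDerivAt (fun ξ : ℝ × ℝ => ξ.1) (ContinuousLinearMap.fst ℝ ℝ ℝ) ξ := hasFDerivAt_fst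
  have h2 : HasFDerivAt (fun ξ : ℝ × ℝ => ξ.2) (ContinuousLinearMap.snd ℝ ℝ ℝ) ξ := hasFDerivAt_snd
  have h3 : HasFDerivAt (fun ξ : ℝ × ℝ => m - η * (ξ.1 ^ 2 + ξ.2 ^ 2))
      ((-(2 * η * ξ.1)) • ContinuousLinearMap.fst ℝ ℝ ℝ +
        (-(2 * η * ξ.2)) • ContinuousLinearMap.snd ℝ ℝ ℝ) ξ := by
    refine ((((h1.pow 2).add (h2.pow 2)).const_mul η).const_sub m).congr_fderiv ?_
    ext <;> simp <;> ring
  refine ⟨_, ((h1.smul_const (pauli 0)).add (h2.smul_const (pauli 1))).add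
    (h3.smul_const (pauli 2)), ?_, ?_⟩
  · change (1 : ℝ) • pauli 0 + (0 : ℝ) • pauli 1 +
      (-(2 * η * ξ.1) * 1 + -(2 * η * ξ.2) * 0) • pauli 2 = _
    module
  · change (0 : ℝ) • pauli 0 + (1 : ℝ) • pauli 1 +
      (-(2 * η * ξ.1) * 0 + -(2 * η * ξ.2) * 1) • pauli 2 = _
    module

lemma trace_commutator (c c₁ c₂ m η x y : ℝ) (A B C : Matrix (Fin 2) (Fin 2) ℂ)
    (hA : A = x • pauli 0 + y • pauli 1 + (m - η * (x ^ 2 + y ^ 2)) • pauli 2)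
    (hB : B = -(c • (pauli 0 - (2 * η * x) • pauli 2) + c₁ • A))
    (hC : C = -(c • (pauli 1 - (2 * η * y) • pauli 2) + c₂ • A)) :
    (((1 / 2 : ℝ) • (1 : Matrix (Fin 2) (Fin 2) ℂ) - c • A) * (B * C - C * B)).trace =
      -4 * Complex.I * ((c ^ 3 * (m + η * (x ^ 2 + y ^ 2)) : ℝ) : ℂ) := by
  obtain ⟨p0, p1, p2⟩ := pauli_eq
  subst hB hC hA
  rw [p0, p1, p2]
  simp [Matrix.trace_fin_two, Matrix.mul_apply, Fin.sum_univ_two]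
  ring_nf

lemma trace_berryCurvature {m : ℝ} (hm : m ≠ 0) (η : ℝ) (ξ : ℝ × ℝ) :
    ((diracProj m η ξ) *
      (fderiv ℝ (diracProj m η) ξ (1, 0) * fderiv ℝ (diracProj m η) ξ (0, 1) -
        fderiv ℝ (diracProj m η) ξ (0, 1) * fderiv ℝ (diracProj m η) ξ (1, 0))).trace =
      (-Complex.I / 2) * (((m + η * (ξ.1 ^ 2 + ξ.2 ^ 2)) /
          ((ξ.1 ^ 2 + ξ.2 ^ 2 + (m - η * (ξ.1 ^ 2 + ξ.2 ^ 2)) ^ 2) ^ ((3 : ℝ) / 2)) : ℝ) : ℂ) := by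
  obtain ⟨L, hL, hL1, hL2⟩ := hasFDerivAt_diracSymbol m η ξ
  have hE := diracEnergy_pos hm η ξ
  have hq : 0 < ξ.1 ^ 2 + ξ.2 ^ 2 + (m - η * (ξ.1 ^ 2 + ξ.2 ^ 2)) ^ 2 :=
    normSq_pos hm η (by positivity)
  have hc : DifferentiableAt ℝ (fun ξ => 1 / (2 * diracEnergy m η ξ)) ξ := by
    have hd : DifferentiableAt ℝ (diracEnergy m η) ξ := DifferentiableAt.sqrt (by fun_prop) hq.ne'
    simp only [one_div]
    exact (hd.const_mul (2 : ℝ)).fun_inv (by positivity)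
  have hP := ((hc.hasFDerivAt.smul hL).const_sub
    ((1 / 2 : ℝ) • (1 : Matrix (Fin 2) (Fin 2) ℂ))).congr_of_eventuallyEq
      (f₁ := diracProj m η) (Filter.Eventually.of_forall (diracProj_eq hm η))
  have hf : ∀ v, fderiv ℝ (diracProj m η) ξ v =
      -((1 / (2 * diracEnergy m η ξ)) • L v +
        fderiv ℝ (fun ξ => 1 / (2 * diracEnergy m η ξ)) ξ v • diracSymbol m η ξ) :=
    fun v => DFunLike.congr_fun hP.fderiv v
  rw [diracProj_eq hm, trace_commutator _ _ _ m η ξ.1 ξ.2 (diracSymbol m η ξ) _ _ rfl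
    ((hf (1, 0)).trans (by rw [hL1])) ((hf (0, 1)).trans (by rw [hL2]))]
  rw [rpow_three_halves hq.le, show √_ = diracEnergy m η ξ from rfl]
  have hE' : (diracEnergy m η ξ : ℂ) ≠ 0 := by exact_mod_cast hE.ne'
  push_cast
  field_simp
  ring

lemma hasDerivAt_radial {m : ℝ} (hm : m ≠ 0) (η r : ℝ) :
    HasDerivAt (fun r => -(m - η * r ^ 2) / √(r ^ 2 + (m - η * r ^ 2) ^ 2))
      (r * ((m + η * r ^ 2) / (r ^ 2 + (m - η * r ^ 2) ^ 2) ^ ((3 : ℝ) / 2))) r := by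
  have hq : 0 < r ^ 2 + (m - η * r ^ 2) ^ 2 := normSq_pos hm η (by positivity)
  have hr : HasDerivAt (fun r : ℝ => r ^ 2) (2 * r) r := by simpa using hasDerivAt_pow 2 r
  have hg := (hr.const_mul η).const_sub m
  refine (hg.neg.div ((hr.add (hg.pow 2)).sqrt hq.ne') (Real.sqrt_ne_zero'.2 hq)).congr_deriv ?_
  have hs := Real.sq_sqrt hq.le
  have hs0 := Real.sqrt_pos.2 hq
  simp only [Pi.add_apply, Pi.pow_apply, Pi.neg_apply]
  rw [rpow_three_halves hq.le]
  set s := √(r ^ 2 + (m - η * r ^ 2) ^ 2)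
  field_simp
  rw [hs]
  push_cast
  ring

lemma tendsto_radial (m : ℝ) {η : ℝ} (hη : η ≠ 0) :
    Filter.Tendsto (fun r => -(m - η * r ^ 2) / √(r ^ 2 + (m - η * r ^ 2) ^ 2))
      Filter.atTop (nhds (Real.sign η)) := by
  have h0 : Filter.Tendsto (fun r : ℝ => (r ^ 2)⁻¹) Filter.atTop (nhds 0) :=
    (Filter.tendsto_pow_atTop two_ne_zero).inv_tendsto_atTop
  have hg : Filter.Tendsto (fun r : ℝ => m * (r ^ 2)⁻¹ - η) Filter.atTop (nhds (-η)) := by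
    simpa using (h0.const_mul m).sub_const η
  have hmain := hg.neg.div (h0.add (hg.pow 2)).sqrt
    (by simpa [Real.sqrt_sq_eq_abs] using hη)
  have hlim : -(-η) / √(0 + (-η) ^ 2) = Real.sign η := by
    rw [zero_add, neg_sq, neg_neg, Real.sqrt_sq_eq_abs]
    rcases hη.lt_or_gt with h | h
    · rw [abs_of_neg h, Real.sign_of_neg h, div_neg, div_self hη]
    · rw [abs_of_pos h, Real.sign_of_pos h, div_self hη]
  rw [hlim] at hmain
  refine hmain.congr' ?_
  filter_upwards [Filter.eventually_gt_atTop 0] with r hr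
  have hr2 : 0 < r ^ 2 := by positivity
  have h1 : r ^ 2 + (m - η * r ^ 2) ^ 2 =
      (r ^ 2) ^ 2 * ((r ^ 2)⁻¹ + (m * (r ^ 2)⁻¹ - η) ^ 2) := by
    field_simp
  have h2 : -(m - η * r ^ 2) = r ^ 2 * -(m * (r ^ 2)⁻¹ - η) := by
    field_simp
  simp only [Pi.div_apply]
  rw [h1, h2, Real.sqrt_mul (by positivity), Real.sqrt_sq hr2.le, mul_div_mul_left _ _ hr2.ne']

lemma integral_radial {m η : ℝ} (hm : m ≠ 0) (hη : η ≠ 0) :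
    ∫ r in Set.Ioi (0 : ℝ), r * ((m + η * r ^ 2) / (r ^ 2 + (m - η * r ^ 2) ^ 2) ^ ((3 : ℝ) / 2)) =
      Real.sign m + Real.sign η := by
  have hderiv := hasDerivAt_radial hm η
  have hlim := tendsto_radial m hη
  have hcont : Continuous fun r : ℝ =>
      r * ((m + η * r ^ 2) / (r ^ 2 + (m - η * r ^ 2) ^ 2) ^ ((3 : ℝ) / 2)) := by
    refine continuous_id.mul (Continuous.div (by fun_prop)
      (Continuous.rpow_const (by fun_prop) fun r => Or.inr (by norm_num)) fun r => ?_)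
    exact (Real.rpow_pos_of_pos (normSq_pos hm η (by positivity)) _).ne'
  set a := √(|m / η|) with ha
  have ha0 : 0 ≤ a := Real.sqrt_nonneg _
  have htail : IntegrableOn (fun r : ℝ =>
      r * ((m + η * r ^ 2) / (r ^ 2 + (m - η * r ^ 2) ^ 2) ^ ((3 : ℝ) / 2))) (Set.Ioi a) := by
    have h := integrableOn_Ioi_deriv_of_nonneg' (a := a) (fun r _ => (hderiv r).const_mul η)
      (fun r hr => ?_) (hlim.const_mul η)
    · have h' := Integrable.const_mul h η⁻¹
      simp only [inv_mul_cancel_left₀ hη] at h'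
      exact h'
    · have hra : a < r := hr
      have hr0 : 0 < r := ha0.trans_lt hra
      have hsq : |m / η| ≤ r ^ 2 := by
        rw [← Real.sq_sqrt (abs_nonneg (m / η))]
        exact pow_le_pow_left₀ ha0 hra.le 2
      have hnum : 0 ≤ η * (m + η * r ^ 2) := by
        have : η * (m + η * r ^ 2) = η ^ 2 * (m / η + r ^ 2) := by field_simp
        rw [this]
        exact mul_nonneg (sq_nonneg η) (by linarith [neg_abs_le (m / η)])
      have hq : 0 < r ^ 2 + (m - η * r ^ 2) ^ 2 := normSq_pos hm η (by positivity)
      rw [show ∀ b d : ℝ, η * (r * (b / d)) = r * (η * b / d) by intros; ring]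
      positivity
  have hint : IntegrableOn (fun r : ℝ =>
      r * ((m + η * r ^ 2) / (r ^ 2 + (m - η * r ^ 2) ^ 2) ^ ((3 : ℝ) / 2))) (Set.Ioi 0) := by
    rw [← Set.Ioc_union_Ioi_eq_Ioi ha0]
    exact (hcont.integrableOn_Ioc).union htail
  rw [integral_Ioi_of_hasDerivAt_of_tendsto' (fun r _ => hderiv r) hint hlim]
  have h0 : m / |m| = Real.sign m := by
    rcases hm.lt_or_gt with h | h
    · rw [abs_of_neg h, Real.sign_of_neg h, div_neg, div_self hm]
    · rw [abs_of_pos h, Real.sign_of_pos h, div_self hm]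
  simp [Real.sqrt_sq_eq_abs, neg_div, h0]
  ring

lemma integral_plane_of_radial (f : ℝ → ℝ) :
    ∫ k : ℝ × ℝ, f (k.1 ^ 2 + k.2 ^ 2) = 2 * π * ∫ r in Set.Ioi (0 : ℝ), r * f (r ^ 2) := by
  rw [← integral_comp_polarCoord_symm, polarCoord_target]
  have h : ∀ p : ℝ × ℝ, p.1 • f ((polarCoord.symm p).1 ^ 2 + (polarCoord.symm p).2 ^ 2) =
      (p.1 * f (p.1 ^ 2)) * 1 := by
    intro p
    rw [polarCoord_symm_apply, smul_eq_mul, mul_one]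
    congr 2
    linear_combination p.1 ^ 2 * Real.cos_sq_add_sin_sq p.2
  simp_rw [h]
  rw [Measure.volume_eq_prod, setIntegral_prod_mul (fun r => r * f (r ^ 2)) (fun _ => 1)]
  simp [pi_pos.le]
  ring

/-- the Chern number of the negative-energy band of the regularized Dirac
operator equals `(1/2)(sgn m + sgn η)`, and is computed by the explicit radial integral. -/
theorem dirac_chern_number (m η : ℝ) (hm : m ≠ 0) (hη : η ≠ 0)
    (hreg : 1 - 2 * |η * m| ≥ 0) :
    (1 / (4 * π)) *
        (∫ k : ℝ × ℝ, (m + η * (k.1 ^ 2 + k.2 ^ 2)) /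
          ((k.1 ^ 2 + k.2 ^ 2 + (m - η * (k.1 ^ 2 + k.2 ^ 2)) ^ 2) ^ ((3 : ℝ) / 2))) =
      (1 / 2) * (Real.sign m + Real.sign η) ∧
    (Complex.I / (2 * (π : ℂ))) *
        (∫ ξ : ℝ × ℝ,
          ((diracProj m η ξ) *
            (fderiv ℝ (diracProj m η) ξ (1, 0) * fderiv ℝ (diracProj m η) ξ (0, 1) -
             fderiv ℝ (diracProj m η) ξ (0, 1) * fderiv ℝ (diracProj m η) ξ (1, 0))).trace) =
      (((1 / 2) * (Real.sign m + Real.sign η) : ℝ) : ℂ) := by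
  have hreal : (1 / (4 * π)) *
        (∫ k : ℝ × ℝ, (m + η * (k.1 ^ 2 + k.2 ^ 2)) /
          ((k.1 ^ 2 + k.2 ^ 2 + (m - η * (k.1 ^ 2 + k.2 ^ 2)) ^ 2) ^ ((3 : ℝ) / 2))) =
      (1 / 2) * (Real.sign m + Real.sign η) := by
    rw [integral_plane_of_radial fun u => (m + η * u) / (u + (m - η * u) ^ 2) ^ ((3 : ℝ) / 2),
      integral_radial hm hη]
    field_simp
    norm_num
  refine ⟨hreal, ?_⟩
  simp_rw [trace_berryCurvature hm η]
  rw [integral_const_mul, integral_complex_ofReal, ← hreal]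
  push_cast
  linear_combination (-(1 : ℂ) / (4 * π) * ((∫ k : ℝ × ℝ, (m + η * (k.1 ^ 2 + k.2 ^ 2)) /
          ((k.1 ^ 2 + k.2 ^ 2 + (m - η * (k.1 ^ 2 + k.2 ^ 2)) ^ 2) ^ ((3 : ℝ) / 2)) : ℝ) : ℂ)) *
    Complex.I_sq
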